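/- arXiv:2305.13348 — 3 statements merged into one kernel-verified Lean document; each statement's English description precedes it below -/
import Mathlib

section
/- Let ε ∈ ℝ with ε ≠ 0 and let Jss, Jsf, Jfs, Jff ∈ ℝ satisfy ε·Jss + Jff ≠ 0 and Jss·Jff − Jsf·Jfs ≠ 0. Let J be the 2×2 real matrix J = ![![ε·Jss, ε·Jsf], ![Jfs, Jff]], and let G̃ be any 2×2 real matrix with entries G̃ss = G̃ 0 0, G̃sf = G̃ 0 1, G̃fs = G̃ 1 0, G̃ff = G̃ 1 1. Then every 2×2 real matrix V satisfying the Lyapunov equation J*V + V*Jᵀ = −G̃ has top-left entry V 0 0 = (−ε²·Jsf²·G̃ff + ε·((G̃fs + G̃sf)·Jsf·Jff − G̃ss·Jss·Jff + G̃ss·Jfs·Jsf) − G̃ss·Jff²) / (2·ε·(ε·Jss + Jff)·(Jff·Jss − Jfs·Jsf)). -/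
open Matrix

theorem lyapunov_slow_variance_exact
    (ε Jss Jsf Jfs Jff : ℝ) (hε : ε ≠ 0)
    (h1 : ε * Jss + Jff ≠ 0) (h2 : Jss * Jff - Jsf * Jfs ≠ 0)
    (J : Matrix (Fin 2) (Fin 2) ℝ) (hJ : J = !![ε * Jss, ε * Jsf; Jfs, Jff])
    (G : Matrix (Fin 2) (Fin 2) ℝ)
    (V : Matrix (Fin 2) (Fin 2) ℝ)
    (hV : J * V + V * Jᵀ = -G) :
    V 0 0 =
      (-(ε ^ 2 * Jsf ^ 2 * G 1 1)
        + ε * ((G 1 0 + G 0 1) * Jsf * Jff - G 0 0 * Jss * Jff + G 0 0 * Jfs * Jsf)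
        - G 0 0 * Jff ^ 2)
      / (2 * ε * (ε * Jss + Jff) * (Jff * Jss - Jfs * Jsf)) := by
  subst hJ
  have e00 := congrFun (congrFun hV 0) 0
  have e01 := congrFun (congrFun hV 0) 1
  have e10 := congrFun (congrFun hV 1) 0
  have e11 := congrFun (congrFun hV 1) 1
  simp [Matrix.mul_apply, Matrix.vecMul, dotProduct, Fin.sum_univ_two] at e00 e01 e10 e11
  have h3 : Jff * Jss - Jfs * Jsf ≠ 0 := by
    intro h
    apply h2
    linarith
  rw [eq_div_iff (by
    exact mul_ne_zero (mul_ne_zero (mul_ne_zero two_ne_zero hε) h1) h3)]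
  linear_combination (Jff * (ε * Jss + Jff) - ε * Jsf * Jfs) * e00
    - ε * Jsf * Jff * (e01 + e10) + ε ^ 2 * Jsf ^ 2 * e11
end

section
/- Let Jss, Jsf, Jfs, Jff ∈ ℝ with Jff < 0 and D := Jss·Jff − Jsf·Jfs > 0, and let G̃ be a 2×2 real matrix with G̃ss := G̃ 0 0 > 0. For ε > 0 set J_ε := ![![ε·Jss, ε·Jsf], ![Jfs, Jff]] and define the ssLNA variance V_ss(ε) := −G̃ss·Jff / (2·ε·D) (which is positive). Then there exist ε₀ > 0 and C > 0 such that for all ε ∈ (0, ε₀) and every 2×2 real matrix V satisfying J_ε*V + V*J_εᵀ = −G̃, the stationary variance of the slow variable V_LNA(ε) := V 0 0 satisfies |V_LNA(ε)/V_ss(ε) − 1| ≤ C·ε; that is, the error between the variance of the slow variable generated by the LNA and by the ssLNA is O(ε) relative to the (order 1/ε) variance itself. -/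
open Matrix

theorem ssLNA_variance_relative_error_O_eps
    (Jss Jsf Jfs Jff : ℝ) (hJff : Jff < 0)
    (hD : Jss * Jff - Jsf * Jfs > 0)
    (G : Matrix (Fin 2) (Fin 2) ℝ) (hG : G 0 0 > 0) :
    ∃ ε₀ > (0 : ℝ), ∃ C > (0 : ℝ), ∀ ε : ℝ, 0 < ε → ε < ε₀ →
      ∀ V : Matrix (Fin 2) (Fin 2) ℝ,
        (!![ε * Jss, ε * Jsf; Jfs, Jff]) * V
          + V * (!![ε * Jss, ε * Jsf; Jfs, Jff])ᵀ = -G →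
        |V 0 0 / (-(G 0 0 * Jff) / (2 * ε * (Jss * Jff - Jsf * Jfs))) - 1|
          ≤ C * ε := by
  obtain ⟨M, hM⟩ : ∃ M, M = |G 0 0 * (Jss * Jff - Jsf * Jfs) - Jsf * (G 0 1 + G 1 0) * Jff
      - Jss * G 0 0 * Jff| + |Jsf ^ 2 * G 1 1| + 1 := ⟨_, rfl⟩
  have hMpos : 0 < M := by rw [hM]; positivity
  have hk2 : 0 < G 0 0 * Jff ^ 2 := mul_pos hG (by nlinarith)
  have ha : 0 < 2 * (|Jss| + 1) := by positivity
  refine ⟨min 1 (-Jff / (2 * (|Jss| + 1))), lt_min one_pos (div_pos (by linarith) ha),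
    2 * M / (G 0 0 * Jff ^ 2), by positivity, ?_⟩
  intro ε hε hlt V hV
  have h1 : ε < 1 := lt_of_lt_of_le hlt (min_le_left _ _)
  have h2 : ε < -Jff / (2 * (|Jss| + 1)) := lt_of_lt_of_le hlt (min_le_right _ _)
  rw [lt_div_iff₀ ha] at h2
  have e00 := congrFun (congrFun hV 0) 0
  have e01 := congrFun (congrFun hV 0) 1
  have e10 := congrFun (congrFun hV 1) 0
  have e11 := congrFun (congrFun hV 1) 1
  simp [Matrix.mul_apply, Matrix.vecMul, dotProduct, Fin.sum_univ_two] at e00 e01 e10 e11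
  have hv : V 0 0 * (2 * ε * (Jss * Jff - Jsf * Jfs)) * (Jff + ε * Jss)
      = -(G 0 0 * (Jff ^ 2 + ε * (Jss * Jff - Jsf * Jfs))) - ε ^ 2 * Jsf ^ 2 * G 1 1
        + ε * Jsf * (G 0 1 + G 1 0) * Jff := by
    linear_combination (Jff ^ 2 + ε * (Jss * Jff - Jsf * Jfs)) * e00
      - ε * Jsf * Jff * (e01 + e10) + ε ^ 2 * Jsf ^ 2 * e11
  obtain ⟨r, hr⟩ : ∃ r, r = V 0 0 / (-(G 0 0 * Jff) / (2 * ε * (Jss * Jff - Jsf * Jfs))) :=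
    ⟨_, rfl⟩
  rw [← hr]
  have hr' : r * (-(G 0 0 * Jff)) = V 0 0 * (2 * ε * (Jss * Jff - Jsf * Jfs)) := by
    have := hJff.ne
    have := hG.ne'
    have := hD.ne'
    have := hε.ne'
    rw [hr, div_div_eq_mul_div, div_mul_cancel₀]
    exact neg_ne_zero.mpr (mul_ne_zero (by assumption) (by assumption))
  rw [← hr'] at hv
  have key : (r - 1) * ((Jff + ε * Jss) * (G 0 0 * Jff)) =
      ε * ((G 0 0 * (Jss * Jff - Jsf * Jfs) - Jsf * (G 0 1 + G 1 0) * Jff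
      - Jss * G 0 0 * Jff) + ε * (Jsf ^ 2 * G 1 1)) := by
    linear_combination -hv
  have hb : |(G 0 0 * (Jss * Jff - Jsf * Jfs) - Jsf * (G 0 1 + G 1 0) * Jff
      - Jss * G 0 0 * Jff) + ε * (Jsf ^ 2 * G 1 1)| ≤ M := by
    refine (abs_add_le _ _).trans ?_
    rw [hM, abs_mul ε, abs_of_pos hε]
    nlinarith [abs_nonneg (Jsf ^ 2 * G 1 1)]
  have hlow : G 0 0 * Jff ^ 2 / 2 ≤ (Jff + ε * Jss) * (G 0 0 * Jff) := by
    have : Jff + ε * Jss ≤ Jff / 2 := by nlinarith [le_abs_self Jss]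
    have h3 : G 0 0 * Jff < 0 := mul_neg_of_pos_of_neg hG hJff
    nlinarith
  have habs := congrArg abs key
  rw [abs_mul, abs_mul ε, abs_of_pos hε,
    abs_of_pos (lt_of_lt_of_le (by positivity) hlow)] at habs
  rw [div_mul_eq_mul_div, le_div_iff₀ hk2]
  have h4 := mul_le_mul_of_nonneg_left hlow (abs_nonneg (r - 1))
  have h5 := mul_le_mul_of_nonneg_left hb hε.le
  nlinarith
end

section
/- Let Jss, Jsf, Jfs, Jff ∈ ℝ with Jff < 0 and Jss·Jff − Jsf·Jfs > 0, and for ε > 0 set J_ε := ![![ε·Jss, ε·Jsf], ![Jfs, Jff]]. Then there exists ε₀ > 0 such that for every ε ∈ (0, ε₀), J_ε has two distinct real negative eigenvalues λ_s(ε) > λ_f(ε); moreover λ_f(ε) → Jff and λ_s(ε)/ε → (Jss·Jff − Jsf·Jfs)/Jff as ε → 0⁺, and consequently the eigenvalue ratio λ_s(ε)/λ_f(ε) → 0 as ε → 0⁺. -/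
open Matrix Polynomial Filter Topology

theorem eigenvalue_disparity_standard_form
    (Jss Jsf Jfs Jff : ℝ) (hJff : Jff < 0)
    (hD : Jss * Jff - Jsf * Jfs > 0) :
    ∃ ε₀ > (0 : ℝ), ∃ lams lamf : ℝ → ℝ,
      (∀ ε : ℝ, 0 < ε → ε < ε₀ →
        lamf ε < lams ε ∧ lams ε < 0 ∧
        Matrix.charpoly (!![ε * Jss, ε * Jsf; Jfs, Jff]) =
          (X - Polynomial.C (lamf ε)) * (X - Polynomial.C (lams ε))) ∧
      Tendsto lamf (nhdsWithin 0 (Set.Ioi 0)) (nhds Jff) ∧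
      Tendsto (fun ε => lams ε / ε) (nhdsWithin 0 (Set.Ioi 0))
        (nhds ((Jss * Jff - Jsf * Jfs) / Jff)) ∧
      Tendsto (fun ε => lams ε / lamf ε) (nhdsWithin 0 (Set.Ioi 0)) (nhds 0) := by
  set D := Jss * Jff - Jsf * Jfs with hDdef
  set T : ℝ → ℝ := fun ε => ε * Jss + Jff with hT
  set Δ : ℝ → ℝ := fun ε => T ε ^ 2 - 4 * (ε * D) with hΔ
  set lf : ℝ → ℝ := fun ε => (T ε - Real.sqrt (Δ ε)) / 2 with hlf
  have hTc : Continuous T := by fun_prop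
  have hΔc : Continuous Δ := by fun_prop
  have hlfc : Continuous lf := by fun_prop
  have hT0 : T 0 = Jff := by simp [hT]
  have hΔ0 : Δ 0 = Jff ^ 2 := by simp [hΔ, hT0]
  have hlf0 : lf 0 = Jff := by
    simp only [hlf, hT0, hΔ0, Real.sqrt_sq_eq_abs, abs_of_neg hJff]
    ring
  have e1 : ∀ᶠ ε in 𝓝[>] (0 : ℝ), T ε < 0 :=
    nhdsWithin_le_nhds (hTc.continuousAt.eventually_lt continuousAt_const (by rw [hT0]; exact hJff))
  have e2 : ∀ᶠ ε in 𝓝[>] (0 : ℝ), 0 < Δ ε :=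
    nhdsWithin_le_nhds (continuousAt_const.eventually_lt hΔc.continuousAt
      (by rw [hΔ0]; exact sq_pos_of_neg hJff))
  obtain ⟨ε₀, hε₀, hsub⟩ := mem_nhdsGT_iff_exists_Ioo_subset.1 (e1.and e2)
  have hlim : Tendsto lf (𝓝[>] 0) (𝓝 Jff) := by
    have := hlfc.tendsto 0
    rw [hlf0] at this
    exact this.mono_left nhdsWithin_le_nhds
  have hid : Tendsto (fun ε : ℝ => ε) (𝓝[>] 0) (𝓝 0) := nhdsWithin_le_nhds
  refine ⟨ε₀, hε₀, fun ε => ε * D / lf ε, lf, ?_, hlim, ?_, ?_⟩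
  · intro ε h0 h1
    obtain ⟨hTn, hΔp⟩ := hsub ⟨h0, h1⟩
    have hs := Real.sqrt_pos.2 hΔp
    have hsq := Real.sq_sqrt hΔp.le
    have hlfn : lf ε < 0 := by simp only [hlf]; linarith
    have hls : ε * D / lf ε = T ε - lf ε := by
      rw [div_eq_iff hlfn.ne]
      simp only [hlf]
      have : Real.sqrt (Δ ε) ^ 2 = T ε ^ 2 - 4 * (ε * D) := hsq
      linarith
    have hprod : lf ε * (T ε - lf ε) = ε * D := by
      rw [← hls]; field_simp [hlfn.ne]
    refine ⟨?_, div_neg_of_pos_of_neg (mul_pos h0 hD) hlfn, ?_⟩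
    · show lf ε < ε * D / lf ε
      rw [hls]; simp only [hlf]; linarith
    · show _ = (X - C (lf ε)) * (X - C (ε * D / lf ε))
      rw [hls, Matrix.charpoly_fin_two]
      have h1 : Matrix.trace !![ε * Jss, ε * Jsf; Jfs, Jff] = T ε := by
        simp [Matrix.trace_fin_two, hT]
      have h2 : Matrix.det !![ε * Jss, ε * Jsf; Jfs, Jff] = lf ε * (T ε - lf ε) := by
        rw [hprod, Matrix.det_fin_two_of, hDdef]; ring
      rw [h1, h2]
      simp only [C_mul, C_sub]
      ring
  · refine (tendsto_const_nhds.div hlim hJff.ne).congr' ?_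
    filter_upwards [self_mem_nhdsWithin] with ε hε
    have : ε ≠ 0 := ne_of_gt hε
    show D / lf ε = ε * D / lf ε / ε
    field_simp
  · have := ((hid.mul_const D).div hlim hJff.ne).div hlim hJff.ne
    rw [zero_mul, zero_div, zero_div] at this
    exact this
end
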